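/- arXiv:2412.07319 — 7 statements merged into one kernel-verified Lean document; each statement's English description precedes it below -/
import Mathlib

section
/- Let G be a group acting by automorphisms on a connected simple graph X such that there are only finitely many G-orbits of vertices and finitely many G-orbits of edges. Let ṽ₁,…,ṽₙ be representatives of the vertex orbits, and suppose there is a set T̃ of edges of X, each joining two of the vertices ṽ₁,…,ṽₙ, lying in pairwise distinct G-orbits, such that the graph on the index set {1,…,n} having an edge {i,j} whenever T̃ contains an edge {ṽᵢ,ṽⱼ} is a tree (a lift of a maximal tree of the quotient graph). Suppose moreover that for every G-orbit of edges of X not containing an edge of T̃ the following data are chosen: (i) if the orbit contains an edge both of whose endpoints lie in the vertex orbit of a single ṽᵢ, a representative edge {ṽᵢ, w} with w ∈ G·ṽᵢ is chosen together with an element f ∈ G satisfying f·ṽᵢ = w; (ii) if the orbit contains an edge whose endpoints lie in the vertex orbits of two distinct representatives ṽᵢ and ṽⱼ, a representative edge {ṽᵢ, w} with w ∈ G·ṽⱼ is chosen together with an element f ∈ G satisfying f·w = ṽⱼ. Let F be the set of all elements f so chosen. Then G is generated by the union of the stabilizers Stab_G(ṽ₁),…,Stab_G(ṽₙ) together with F.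 In particular, if each Stab_G(ṽᵢ) is finitely generated, then G is finitely generated. -/
/-- The condition that the ordered pair `(u, w)` (an edge of `X`) lies, after translating by
some `g ∈ G`, in the position of a chosen representative edge `{ṽᵢ, w'}` of its orbit,
for which an element `f ∈ F` has been chosen as in the theorem:
either `w' ∈ G·ṽᵢ` and `f • ṽᵢ = w'` (loop case), or `w' ∈ G·ṽⱼ` for some `j ≠ i`
and `f • w' = ṽⱼ` (non-loop case). -/
def HasChosenRep {G V : Type*} [Group G] [MulAction G V] {n : ℕ}
    (vt : Fin n → V) (F : Set G) (u w : V) : Prop :=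
  ∃ (g : G) (i : Fin n), g • u = vt i ∧
    ((g • w ∈ MulAction.orbit G (vt i) ∧ ∃ f ∈ F, f • vt i = g • w) ∨
     (∃ j : Fin n, j ≠ i ∧ g • w ∈ MulAction.orbit G (vt j) ∧ ∃ f ∈ F, f • (g • w) = vt j))

/-- In a connected graph, a property of vertices which holds at one vertex and passes along
edges holds at every vertex. -/
theorem SimpleGraph.Connected.forall_of_adj {V : Type*} {X : SimpleGraph V} (hconn : X.Connected)
    {P : V → Prop} {v₀ : V} (h₀ : P v₀) (hstep : ∀ u w : V, X.Adj u w → P u → P w) (v : V) :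
    P v := by
  obtain ⟨p⟩ := hconn v₀ v
  induction p with
  | nil => exact h₀
  | cons hadj _ ih => exact ih (hstep _ _ hadj h₀)

/-- A subgroup containing the stabilizers of a family of points in distinct orbits contains every
element which maps some point of the family into the family. -/
theorem Subgroup.mem_of_smul_eq_of_stabilizer_le {G V ι : Type*} [Group G] [MulAction G V]
    {vt : ι → V} (hdistinct : ∀ i j : ι, (∃ g : G, g • vt i = vt j) → i = j)
    {H : Subgroup G} (hstab : ∀ i, MulAction.stabilizer G (vt i) ≤ H)
    {g : G} {i j : ι} (h : g • vt i = vt j) : g ∈ H := by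
  obtain rfl := hdistinct i j ⟨g, h⟩
  exact hstab i (MulAction.mem_stabilizer_iff.mpr h)

/-- If the edge `{vt a, w}`, in either orientation, has a chosen representative, then a subgroup
containing the stabilizers and `F` moves some `vt b` to `w`. -/
theorem HasChosenRep.exists_smul_eq {G V : Type*} [Group G] [MulAction G V] {n : ℕ}
    {vt : Fin n → V} (hdistinct : ∀ i j : Fin n, (∃ g : G, g • vt i = vt j) → i = j)
    {F : Set G} {H : Subgroup G} (hstab : ∀ i, MulAction.stabilizer G (vt i) ≤ H) (hFH : F ⊆ H)
    {a : Fin n} {w : V} (h : HasChosenRep vt F (vt a) w ∨ HasChosenRep vt F w (vt a)) :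
    ∃ g ∈ H, ∃ b, g • vt b = w := by
  have key {g : G} {i j : Fin n} (h : g • vt i = vt j) : g ∈ H :=
    Subgroup.mem_of_smul_eq_of_stabilizer_le hdistinct hstab h
  rcases h with ⟨g, i, hg, h⟩ | ⟨g, i, hg, h⟩
  · have hgH := key hg
    rcases h with ⟨-, f, hf, h⟩ | ⟨j, -, -, f, hf, h⟩
    · exact ⟨g⁻¹ * f, H.mul_mem (H.inv_mem hgH) (hFH hf), i, by rw [mul_smul, h, inv_smul_smul]⟩
    · exact ⟨g⁻¹ * f⁻¹, H.mul_mem (H.inv_mem hgH) (H.inv_mem (hFH hf)), j, by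
        rw [mul_smul, ← h, inv_smul_smul, inv_smul_smul]⟩
  · suffices hgH : g ∈ H from ⟨g⁻¹, H.inv_mem hgH, i, by rw [← hg, inv_smul_smul]⟩
    rcases h with ⟨-, f, hf, h⟩ | ⟨j, -, -, f, hf, h⟩
    · have hm : (f⁻¹ * g) • vt a = vt i := by rw [mul_smul, ← h, inv_smul_smul]
      exact (H.mul_mem_cancel_left (H.inv_mem (hFH hf))).mp (key hm)
    · rw [← mul_smul] at h
      exact (H.mul_mem_cancel_left (hFH hf)).mp (key h)

/-- A group `G` acting by automorphisms on a connected simple graph `X` with finitely many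
orbits of vertices and edges is generated by the vertex stabilizers of orbit representatives
together with a set `F` of elements chosen for the edge orbits not meeting a lifted maximal
tree. -/
theorem generating_set_of_group_acting_on_graph
    {G V : Type*} [Group G] (X : SimpleGraph V) [MulAction G V]
    -- G acts on X by graph automorphisms
    (hact : ∀ (g : G) (u v : V), X.Adj u v ↔ X.Adj (g • u) (g • v))
    -- X is connected
    (hconn : X.Connected)
    -- representatives ṽ₁, …, ṽₙ of the (finitely many) vertex orbits
    (n : ℕ) (vt : Fin n → V)
    (hcover : ∀ v : V, ∃ (i : Fin n) (g : G), g • vt i = v)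
    (hdistinct : ∀ i j : Fin n, (∃ g : G, g • vt i = vt j) → i = j)
    -- a lifted maximal tree T̃: a tree `Tr` on the index set whose edges {i,j} lift to
    -- edges {ṽᵢ, ṽⱼ} of X lying in pairwise distinct G-orbits
    (Tr : SimpleGraph (Fin n)) (hTree : Tr.IsTree)
    (hTlift : ∀ i j : Fin n, Tr.Adj i j → X.Adj (vt i) (vt j))
    (hTdistinct : ∀ i j i' j' : Fin n, Tr.Adj i j → Tr.Adj i' j' →
      (∃ g : G, (g • vt i = vt i' ∧ g • vt j = vt j') ∨
                (g • vt i = vt j' ∧ g • vt j = vt i')) →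
      (i = i' ∧ j = j') ∨ (i = j' ∧ j = i'))
    -- finitely many G-orbits of edges
    (m : ℕ) (E : Fin m → V × V)
    (hEcover : ∀ u w : V, X.Adj u w → ∃ (l : Fin m) (g : G),
      (g • u = (E l).1 ∧ g • w = (E l).2) ∨ (g • u = (E l).2 ∧ g • w = (E l).1))
    -- the set F of chosen elements: every edge orbit either contains an edge of the lifted
    -- tree, or has a chosen representative edge with a chosen element of F as in the theorem
    (F : Set G)
    (hF : ∀ u w : V, X.Adj u w →
      (∃ (g : G) (i j : Fin n), Tr.Adj i j ∧
        ((g • u = vt i ∧ g • w = vt j) ∨ (g • u = vt j ∧ g • w = vt i))) ∨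
      HasChosenRep vt F u w ∨ HasChosenRep vt F w u) :
    Subgroup.closure ((⋃ i : Fin n, (MulAction.stabilizer G (vt i) : Set G)) ∪ F) = ⊤ := by
  set H := Subgroup.closure ((⋃ i : Fin n, (MulAction.stabilizer G (vt i) : Set G)) ∪ F)
  have hstab (i : Fin n) : MulAction.stabilizer G (vt i) ≤ H := fun g hg =>
    Subgroup.subset_closure (Or.inl (Set.mem_iUnion.mpr ⟨i, hg⟩))
  have hFH : F ⊆ H := fun f hf => Subgroup.subset_closure (Or.inr hf)
  have key {g : G} {i j : Fin n} (h : g • vt i = vt j) : g ∈ H :=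
    Subgroup.mem_of_smul_eq_of_stabilizer_le hdistinct hstab h
  have hnbr (a : Fin n) (w : V) (hw : X.Adj (vt a) w) : ∃ g ∈ H, ∃ b, g • vt b = w := by
    rcases hF _ _ hw with ⟨g, i, j, -, ⟨hu, hw⟩ | ⟨hu, hw⟩⟩ | h
    · exact ⟨g⁻¹, H.inv_mem (key hu), j, by rw [← hw, inv_smul_smul]⟩
    · exact ⟨g⁻¹, H.inv_mem (key hu), i, by rw [← hw, inv_smul_smul]⟩
    · exact HasChosenRep.exists_smul_eq hdistinct hstab hFH h
  obtain ⟨v₀⟩ := hconn.nonempty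
  obtain ⟨a, -⟩ := hcover v₀
  have hall (v : V) : ∃ h ∈ H, ∃ b, h • vt b = v := by
    refine hconn.forall_of_adj (P := fun v => ∃ h ∈ H, ∃ b, h • vt b = v)
      ⟨1, H.one_mem, a, one_smul G (vt a)⟩ ?_ v
    rintro _ w hadj ⟨h, hh, b, rfl⟩
    rw [hact h⁻¹, inv_smul_smul] at hadj
    obtain ⟨g, hg, c, hc⟩ := hnbr b _ hadj
    exact ⟨h * g, H.mul_mem hh hg, c, by rw [mul_smul, hc, smul_inv_smul]⟩
  refine (Subgroup.eq_top_iff' H).mpr fun g => ?_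
  obtain ⟨h, hh, b, hb⟩ := hall (g • vt a)
  have hm : (h⁻¹ * g) • vt a = vt b := by rw [mul_smul, ← hb, inv_smul_smul]
  exact (H.mul_mem_cancel_left (H.inv_mem hh)).mp (key hm)
end

section
/- Let k be a prime. Let u ∈ ℤ⁴ be a primitive vector (the gcd of its coordinates is 1) and let x ∈ (ℤ/kℤ)⁴ be the reduction of u modulo k. Let y ∈ (ℤ/kℤ)⁴ be a nonzero vector with ω_k(x,y) = 1. Then there exists a primitive vector v ∈ ℤ⁴ such that v ≡ y (mod k) and ω(u,v) = 1. -/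
/-- The standard symplectic form on `ℤ⁴`: `ω(x,y) = x₁y₂ − x₂y₁ + x₃y₄ − x₄y₃`
(written with 0-based indices). -/
def omegaZ (x y : Fin 4 → ℤ) : ℤ :=
  x 0 * y 1 - x 1 * y 0 + x 2 * y 3 - x 3 * y 2

/-- The induced symplectic form on `(ℤ/kℤ)⁴`. -/
def omegaMod (k : ℕ) (x y : Fin 4 → ZMod k) : ZMod k :=
  x 0 * y 1 - x 1 * y 0 + x 2 * y 3 - x 3 * y 2

/-- An integer vector is primitive if the gcd of its coordinates is 1, i.e. every common
divisor is a unit. -/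
def IsPrimitiveVec (u : Fin 4 → ℤ) : Prop :=
  ∀ d : ℤ, (∀ i, d ∣ u i) → IsUnit d

/-- Bézout's identity for a primitive vector. -/
theorem IsPrimitiveVec.exists_sum_mul_eq_one {u : Fin 4 → ℤ} (hu : IsPrimitiveVec u) :
    ∃ c : Fin 4 → ℤ, ∑ i, c i * u i = 1 := by
  obtain ⟨d, hd⟩ := (IsPrincipalIdealRing.principal (Ideal.span (Set.range u))).principal
  have hunit : IsUnit d := hu d fun i => by
    rw [← Ideal.mem_span_singleton, Ideal.span, ← hd]
    exact Ideal.subset_span (Set.mem_range_self i)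
  have hone : (1 : ℤ) ∈ Ideal.span (Set.range u) := by
    rw [hd]
    exact Ideal.mem_span_singleton.mpr hunit.dvd
  exact Ideal.mem_span_range_iff_exists_fun.mp hone

theorem IsPrimitiveVec.exists_omegaZ_eq_one {u : Fin 4 → ℤ} (hu : IsPrimitiveVec u) :
    ∃ z : Fin 4 → ℤ, omegaZ u z = 1 := by
  obtain ⟨c, hc⟩ := hu.exists_sum_mul_eq_one
  refine ⟨![-c 1, c 0, -c 3, c 2], ?_⟩
  rw [Fin.sum_univ_four] at hc
  simp only [omegaZ, Matrix.cons_val]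
  linarith

theorem isPrimitiveVec_of_omegaZ_eq_one {u v : Fin 4 → ℤ} (h : omegaZ u v = 1) :
    IsPrimitiveVec v := by
  intro d hd
  rw [isUnit_iff_dvd_one, ← h]
  exact dvd_sub (dvd_add (dvd_sub ((hd 1).mul_left _) ((hd 0).mul_left _))
    ((hd 3).mul_left _)) ((hd 2).mul_left _)

theorem omegaZ_sub_mul (u w z : Fin 4 → ℤ) (a : ℤ) :
    omegaZ u (fun i => w i - a * z i) = omegaZ u w - a * omegaZ u z := by
  simp only [omegaZ]
  ring

theorem intCast_omegaZ (k : ℕ) (u w : Fin 4 → ℤ) :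
    (omegaZ u w : ZMod k) = omegaMod k (fun i => (u i : ZMod k)) (fun i => (w i : ZMod k)) := by
  simp [omegaZ, omegaMod]

/-- Let `k` be prime, `u ∈ ℤ⁴` primitive with reduction `x` mod `k`, and `y ∈ (ℤ/kℤ)⁴`
nonzero with `ω_k(x,y) = 1`. Then there is a primitive `v ∈ ℤ⁴` with `v ≡ y (mod k)` and
`ω(u,v) = 1`. -/
theorem lift_symplectic_dual_vector
    (k : ℕ) (hk : Nat.Prime k)
    (u : Fin 4 → ℤ) (hu : IsPrimitiveVec u)
    (y : Fin 4 → ZMod k) (hy : y ≠ 0)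
    (hxy : omegaMod k (fun i => ((u i : ZMod k))) y = 1) :
    ∃ v : Fin 4 → ℤ, IsPrimitiveVec v ∧ (∀ i, ((v i : ZMod k)) = y i) ∧ omegaZ u v = 1 := by
  obtain ⟨z, hz⟩ := hu.exists_omegaZ_eq_one
  choose w hw using fun i => ZMod.intCast_surjective (y i)
  obtain ⟨m, hm⟩ : (k : ℤ) ∣ omegaZ u w - 1 := by
    rw [← ZMod.intCast_zmod_eq_zero_iff_dvd]
    push_cast
    rw [intCast_omegaZ, funext hw, hxy, sub_self]
  have hv : omegaZ u (fun i => w i - k * m * z i) = 1 := by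
    rw [omegaZ_sub_mul, hz]
    linarith
  exact ⟨_, isPrimitiveVec_of_omegaZ_eq_one hv, fun i => by simp [hw], hv⟩
end

section
/- Let k be a prime and let Ḡ_k = {B ∈ Sp(4,ℤ/kℤ) : B₂₁ = B₂₃ = B₂₄ = 0}. Then the natural action of Ḡ_k on the set of nonzero vectors of (ℤ/kℤ)⁴ has exactly three orbits, namely: the orbit of e₂, which equals {v : v₂ ≠ 0}; the orbit of e₃, which equals {v : v₂ = 0 and (v₃,v₄) ≠ (0,0)}; and the orbit of e₁, which equals {v : v₂ = v₃ = v₄ = 0 and v₁ ≠ 0}. -/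
/-- `B ∈ Sp(4, ℤ/kℤ)`: `B` preserves the symplectic form `ω_k`. -/
def IsSympMod (k : ℕ) (B : Matrix (Fin 4) (Fin 4) (ZMod k)) : Prop :=
  ∀ x y : Fin 4 → ZMod k, omegaMod k (B.mulVec x) (B.mulVec y) = omegaMod k x y

/-- `Ḡ_k = {B ∈ Sp(4,ℤ/kℤ) : B₂₁ = B₂₃ = B₂₄ = 0}` (1-based entries; 0-based row 1,
columns 0, 2, 3). -/
def Gbar (k : ℕ) : Set (Matrix (Fin 4) (Fin 4) (ZMod k)) :=
  {B | IsSympMod k B ∧ B 1 0 = 0 ∧ B 1 2 = 0 ∧ B 1 3 = 0}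

theorem mulVec_fin_four {R : Type*} [CommRing R] (B : Matrix (Fin 4) (Fin 4) R)
    (x : Fin 4 → R) (i : Fin 4) :
    B.mulVec x i = B i 0 * x 0 + B i 1 * x 1 + B i 2 * x 2 + B i 3 * x 3 := by
  simp [Matrix.mulVec, dotProduct, Fin.sum_univ_four]

/-- In a matrix of `Ḡ_k`, the first column is a multiple of `e₁`, the product of the first two
diagonal entries is `1`, and the lower right block has determinant `1`. -/
theorem entries_of_mem_Gbar {k : ℕ} {B : Matrix (Fin 4) (Fin 4) (ZMod k)} (hB : B ∈ Gbar k) :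
    B 2 0 = 0 ∧ B 3 0 = 0 ∧ B 0 0 * B 1 1 = 1 ∧ B 2 2 * B 3 3 - B 3 2 * B 2 3 = 1 := by
  obtain ⟨hω, h0, h2, h3⟩ := hB
  have h01 := hω ![1, 0, 0, 0] ![0, 1, 0, 0]
  have h02 := hω ![1, 0, 0, 0] ![0, 0, 1, 0]
  have h03 := hω ![1, 0, 0, 0] ![0, 0, 0, 1]
  have h23 := hω ![0, 0, 1, 0] ![0, 0, 0, 1]
  simp [omegaMod, mulVec_fin_four, h0, h2, h3] at h01 h02 h03 h23
  have h20 : B 2 0 = 0 := by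
    linear_combination -B 2 0 * h23 - B 2 3 * h02 + B 2 2 * h03
  have h30 : B 3 0 = 0 := by
    linear_combination -B 3 0 * h23 - B 3 3 * h02 + B 3 2 * h03
  refine ⟨h20, h30, ?_, h23⟩
  simpa [h20, h30] using h01

theorem exists_mem_Gbar_mulVec_e₂ {k : ℕ} (v : Fin 4 → ZMod k) (c : ZMod k) (hc : v 1 * c = 1) :
    ∃ B ∈ Gbar k, B.mulVec ![0, 1, 0, 0] = v := by
  refine ⟨!![c, v 0, -v 3 * c, v 2 * c; 0, v 1, 0, 0; 0, v 2, 1, 0; 0, v 3, 0, 1],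
    ⟨fun x y => ?_, by simp, by simp, by simp⟩, ?_⟩
  · simp [omegaMod, mulVec_fin_four]
    grind
  · ext i
    fin_cases i <;> simp [mulVec_fin_four]

theorem exists_mem_Gbar_mulVec_e₃ {k : ℕ} (v : Fin 4 → ZMod k) (h1 : v 1 = 0) (r s : ZMod k)
    (hrs : v 2 * s - v 3 * r = 1) : ∃ B ∈ Gbar k, B.mulVec ![0, 0, 1, 0] = v := by
  refine ⟨!![1, 0, v 0, 0; 0, 1, 0, 0; 0, -v 0 * r, v 2, r; 0, -v 0 * s, v 3, s],
    ⟨fun x y => ?_, by simp, by simp, by simp⟩, ?_⟩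
  · simp [omegaMod, mulVec_fin_four]
    grind
  · ext i
    fin_cases i <;> simp [mulVec_fin_four, h1]

theorem exists_mem_Gbar_mulVec_e₁ {k : ℕ} (v : Fin 4 → ZMod k) (h1 : v 1 = 0) (h2 : v 2 = 0)
    (h3 : v 3 = 0) (c : ZMod k) (hc : v 0 * c = 1) :
    ∃ B ∈ Gbar k, B.mulVec ![1, 0, 0, 0] = v := by
  refine ⟨!![v 0, 0, 0, 0; 0, c, 0, 0; 0, 0, 1, 0; 0, 0, 0, 1],
    ⟨fun x y => ?_, by simp, by simp, by simp⟩, ?_⟩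
  · simp [omegaMod, mulVec_fin_four]
    grind
  · ext i
    fin_cases i <;> simp [mulVec_fin_four, h1, h2, h3]

/-- For `k` prime, the action of `Ḡ_k` on nonzero vectors of `(ℤ/kℤ)⁴` has exactly three
orbits: the orbit of `e₂` is `{v : v₂ ≠ 0}`, the orbit of `e₃` is
`{v : v₂ = 0, (v₃,v₄) ≠ (0,0)}`, and the orbit of `e₁` is `{v : v₂ = v₃ = v₄ = 0, v₁ ≠ 0}`. -/
theorem Gbar_orbits_on_nonzero_vectors
    (k : ℕ) (hk : Nat.Prime k) (v : Fin 4 → ZMod k) (hv : v ≠ 0) :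
    ((∃ B ∈ Gbar k, B.mulVec ![0, 1, 0, 0] = v) ↔ v 1 ≠ 0) ∧
    ((∃ B ∈ Gbar k, B.mulVec ![0, 0, 1, 0] = v) ↔ (v 1 = 0 ∧ ¬(v 2 = 0 ∧ v 3 = 0))) ∧
    ((∃ B ∈ Gbar k, B.mulVec ![1, 0, 0, 0] = v) ↔
      (v 1 = 0 ∧ v 2 = 0 ∧ v 3 = 0 ∧ v 0 ≠ 0)) := by
  have : Fact k.Prime := ⟨hk⟩
  refine ⟨⟨?_, fun h => ?_⟩, ⟨?_, fun ⟨h1, h⟩ => ?_⟩, ⟨?_, fun ⟨h1, h2, h3, h0⟩ => ?_⟩⟩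
  · rintro ⟨B, hB, rfl⟩
    obtain ⟨-, -, h, -⟩ := entries_of_mem_Gbar hB
    simpa [mulVec_fin_four] using right_ne_zero_of_mul_eq_one h
  · exact exists_mem_Gbar_mulVec_e₂ v _ (mul_inv_cancel₀ h)
  · rintro ⟨B, hB, rfl⟩
    obtain ⟨-, -, -, h⟩ := entries_of_mem_Gbar hB
    obtain ⟨-, -, h12, -⟩ := hB
    refine ⟨by simpa [mulVec_fin_four] using h12, fun ⟨h22, h32⟩ => ?_⟩
    simp [mulVec_fin_four] at h22 h32
    simp [h22, h32] at h
  · by_cases h2 : v 2 = 0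
    · have h3 : v 3 ≠ 0 := fun h3 => h ⟨h2, h3⟩
      exact exists_mem_Gbar_mulVec_e₃ v h1 (-(v 3)⁻¹) 0 (by simp [h3])
    · exact exists_mem_Gbar_mulVec_e₃ v h1 0 (v 2)⁻¹ (by simp [h2])
  · rintro ⟨B, hB, rfl⟩
    obtain ⟨h20, h30, h, -⟩ := entries_of_mem_Gbar hB
    simpa [mulVec_fin_four, h20, h30, hB.2.1] using left_ne_zero_of_mul_eq_one h
  · exact exists_mem_Gbar_mulVec_e₁ v h1 h2 h3 _ (mul_inv_cancel₀ h0)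
end

section
/- Let k be a prime and let G_k = {A ∈ Sp(4,ℤ) : k divides A₂₁, A₂₃ and A₂₄}. Then the stabilizer {A ∈ G_k : A·e₃ = e₃ or A·e₃ = −e₃} equals the subgroup of Sp(4,ℤ) generated by the set φ(Γ₀(k)) together with the elements τ_{e₁}, τ_{e₁−e₃}, τ_{e₃}, M^k and −I, where M is the matrix with rows (1,0,0,0), (0,1,0,1), (−1,0,1,0), (0,0,0,1) and I is the identity matrix. -/
open Matrix

abbrev M4 := Matrix (Fin 4) (Fin 4) ℤ

/-- `A ∈ Sp(4,ℤ)`: `A` preserves the symplectic form `ω`. -/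
def IsSymp (A : M4) : Prop :=
  ∀ x y : Fin 4 → ℤ, omegaZ (A.mulVec x) (A.mulVec y) = omegaZ x y

/-- The symplectic transvection `τ_v(x) = x − ω(x,v)v`, as a matrix:
`τ_v = 1 − v·(v₂, −v₁, v₄, −v₃)ᵀ` (0-based: `(v 1, -v 0, v 3, -v 2)`). -/
def tau (v : Fin 4 → ℤ) : M4 :=
  1 - Matrix.vecMulVec v ![v 1, -v 0, v 3, -v 2]

/-- The matrix `M` of the paper. -/
def Mmat : M4 := !![1, 0, 0, 0; 0, 1, 0, 1; -1, 0, 1, 0; 0, 0, 0, 1]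

/-- The stabilizer of `±e₃` in `G_k = {A ∈ Sp(4,ℤ) : k ∣ A₂₁, A₂₃, A₂₄}`, viewed inside
`GL(4,ℤ)`. -/
def stabE3 (k : ℕ) : Set (GL (Fin 4) ℤ) :=
  {A | IsSymp (A : M4) ∧
    (k : ℤ) ∣ (A : M4) 1 0 ∧ (k : ℤ) ∣ (A : M4) 1 2 ∧ (k : ℤ) ∣ (A : M4) 1 3 ∧
    ((A : M4).mulVec ![0, 0, 1, 0] = ![0, 0, 1, 0] ∨
     (A : M4).mulVec ![0, 0, 1, 0] = -![0, 0, 1, 0])}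

/-- The generating set: `φ(Γ₀(k))` together with `τ_{e₁}`, `τ_{e₁−e₃}`, `τ_{e₃}`, `M^k`
and `−I`. -/
def gensE3 (k : ℕ) : Set (GL (Fin 4) ℤ) :=
  {g | ∃ a b c d : ℤ, a * d - b * c = 1 ∧ (k : ℤ) ∣ c ∧
      (g : M4) = !![a, b, 0, 0; c, d, 0, 0; 0, 0, 1, 0; 0, 0, 0, 1]} ∪
  {g | (g : M4) = tau ![1, 0, 0, 0]} ∪
  {g | (g : M4) = tau ![1, 0, -1, 0]} ∪
  {g | (g : M4) = tau ![0, 0, 1, 0]} ∪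
  {g | (g : M4) = Mmat ^ k} ∪
  {g | (g : M4) = -1}

theorem isSymp_mul {A B : M4} (hA : IsSymp A) (hB : IsSymp B) : IsSymp (A * B) := fun x y => by
  rw [← mulVec_mulVec, ← mulVec_mulVec, hA, hB]

theorem isSymp_inv {A : GL (Fin 4) ℤ} (hA : IsSymp (A : M4)) :
    IsSymp ((A⁻¹ : GL (Fin 4) ℤ) : M4) := fun x y => by
  rw [← hA, mulVec_mulVec, mulVec_mulVec, Units.mul_inv, one_mulVec, one_mulVec]

theorem isSymp_one : IsSymp 1 := fun x y => by rw [one_mulVec, one_mulVec]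

theorem isSymp_neg {A : M4} (hA : IsSymp A) : IsSymp (-A) := fun x y => by
  rw [← hA x y]
  simp only [neg_mulVec, omegaZ, Pi.neg_apply]
  ring

/-- The second row of `A⁻¹` vanishes modulo `k` wherever that of `A` does, off the diagonal. -/
theorem dvd_inv_row {k : ℤ} {A : GL (Fin 4) ℤ} (h0 : k ∣ (A : M4) 1 0) (h2 : k ∣ (A : M4) 1 2)
    (h3 : k ∣ (A : M4) 1 3) {j : Fin 4} (hj : j ≠ 1) :
    k ∣ ((A⁻¹ : GL (Fin 4) ℤ) : M4) 1 j := by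
  set B : M4 := ((A⁻¹ : GL (Fin 4) ℤ) : M4) with hB
  have hAB : (A : M4) * B = 1 := A.mul_inv
  have h (i : Fin 4) := congrFun (congrFun hAB 1) i
  simp only [mul_apply, Fin.sum_univ_four] at h
  have h1 := h 1
  have hj' := h j
  rw [one_apply_eq] at h1
  rw [one_apply_ne hj.symm] at hj'
  obtain ⟨x, hx⟩ := h0
  obtain ⟨y, hy⟩ := h2
  obtain ⟨z, hz⟩ := h3
  rw [hx, hy, hz] at h1 hj'
  refine ⟨B 1 j * (x * B 0 1 + y * B 2 1 + z * B 3 1) -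
    B 1 1 * (x * B 0 j + y * B 2 j + z * B 3 j), ?_⟩
  linear_combination B 1 1 * hj' - B 1 j * h1

/-- The stabilizer of `±e₃` as a subgroup. -/
def stabE3Subgroup (k : ℕ) : Subgroup (GL (Fin 4) ℤ) where
  carrier := stabE3 k
  one_mem' := ⟨isSymp_one, by simp, by simp, by simp, Or.inl (one_mulVec _)⟩
  mul_mem' := by
    rintro A B ⟨hA, a0, a2, a3, ae⟩ ⟨hB, b0, b2, b3, be⟩
    refine ⟨isSymp_mul hA hB, ?_, ?_, ?_, ?_⟩
    · simp only [Units.val_mul, mul_apply, Fin.sum_univ_four]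
      exact dvd_add (dvd_add (dvd_add (a0.mul_right _) (b0.mul_left _)) (a2.mul_right _))
        (a3.mul_right _)
    · simp only [Units.val_mul, mul_apply, Fin.sum_univ_four]
      exact dvd_add (dvd_add (dvd_add (a0.mul_right _) (b2.mul_left _)) (a2.mul_right _))
        (a3.mul_right _)
    · simp only [Units.val_mul, mul_apply, Fin.sum_univ_four]
      exact dvd_add (dvd_add (dvd_add (a0.mul_right _) (b3.mul_left _)) (a2.mul_right _))
        (a3.mul_right _)
    · rw [Units.val_mul, ← mulVec_mulVec]
      rcases ae with ae | ae <;> rcases be with be | be <;>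
        rw [be] <;> simp only [mulVec_neg, ae, neg_neg, true_or, or_true]
  inv_mem' := by
    rintro A ⟨hA, a0, a2, a3, ae⟩
    refine ⟨isSymp_inv hA, dvd_inv_row a0 a2 a3 (by decide), dvd_inv_row a0 a2 a3 (by decide),
      dvd_inv_row a0 a2 a3 (by decide), ?_⟩
    have h : ((A⁻¹ : GL (Fin 4) ℤ) : M4) *ᵥ ((A : M4) *ᵥ ![0, 0, 1, 0]) = ![0, 0, 1, 0] := by
      rw [mulVec_mulVec, Units.inv_mul, one_mulVec]
    rcases ae with ae | ae
    · left
      rwa [ae] at h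
    · right
      rw [ae, mulVec_neg] at h
      exact neg_eq_iff_eq_neg.mp h

/-- The Heisenberg matrix with parameters `p, q, t`, a symplectic matrix fixing `e₃`. -/
def heisMat (p q t : ℤ) : M4 := !![1, 0, 0, p; 0, 1, 0, q; -q, p, 1, t; 0, 0, 0, 1]

theorem heisMat_mul (p q t p' q' t' : ℤ) : heisMat p q t * heisMat p' q' t' =
    heisMat (p + p') (q + q') (t + t' + (p * q' - q * p')) := by
  ext i j
  fin_cases i <;> fin_cases j <;> simp [heisMat, mul_apply, Fin.sum_univ_four] <;> ring

theorem heisMat_zero : heisMat 0 0 0 = 1 := by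
  ext i j
  fin_cases i <;> fin_cases j <;> rfl

/-- The Heisenberg matrix as an invertible matrix. -/
def heis (p q t : ℤ) : GL (Fin 4) ℤ where
  val := heisMat p q t
  inv := heisMat (-p) (-q) (-t)
  val_inv := by rw [heisMat_mul, ← heisMat_zero]; congr 1 <;> ring
  inv_val := by rw [heisMat_mul, ← heisMat_zero]; congr 1 <;> ring

theorem heis_mul (p q t p' q' t' : ℤ) : heis p q t * heis p' q' t' =
    heis (p + p') (q + q') (t + t' + (p * q' - q * p')) :=
  Units.ext (heisMat_mul p q t p' q' t')

theorem Mmat_pow (k : ℕ) : Mmat ^ k = heisMat 0 k 0 := by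
  have hM : Mmat = heisMat 0 1 0 := rfl
  induction k with
  | zero => rw [pow_zero, Nat.cast_zero, heisMat_zero]
  | succ n ih => rw [pow_succ, ih, hM, heisMat_mul]; simp

/-- The embedding `φ` of a matrix in `SL(2,ℤ)` as the upper left block. -/
def phiMat (a b c d : ℤ) : M4 := !![a, b, 0, 0; c, d, 0, 0; 0, 0, 1, 0; 0, 0, 0, 1]

theorem phiMat_mul_adj {a b c d : ℤ} (h : a * d - b * c = 1) :
    phiMat a b c d * phiMat d (-b) (-c) a = 1 := by
  ext i j
  fin_cases i <;> fin_cases j <;> simp [phiMat, mul_apply, Fin.sum_univ_four] <;>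
    first | linear_combination h | ring

/-- `phiMat` as an invertible matrix. -/
def phi (a b c d : ℤ) (h : a * d - b * c = 1) : GL (Fin 4) ℤ where
  val := phiMat a b c d
  inv := phiMat d (-b) (-c) a
  val_inv := phiMat_mul_adj h
  inv_val := by
    have := phiMat_mul_adj (a := d) (b := -b) (c := -c) (d := a) (by linear_combination h)
    rwa [neg_neg, neg_neg] at this

theorem isSymp_phiMat {a b c d : ℤ} (h : a * d - b * c = 1) : IsSymp (phiMat a b c d) :=
  fun x y => by
    simp only [omegaZ, phiMat, mulVec, dotProduct, Fin.sum_univ_four]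
    simp
    linear_combination (x 0 * y 1 - x 1 * y 0) * h

theorem isSymp_heisMat (p q t : ℤ) : IsSymp (heisMat p q t) := fun x y => by
  simp only [omegaZ, heisMat, mulVec, dotProduct, Fin.sum_univ_four]
  simp
  ring

theorem phi_mem_stabE3 {k : ℕ} {g : GL (Fin 4) ℤ} {a b c d : ℤ} (h : a * d - b * c = 1)
    (hc : (k : ℤ) ∣ c) (hg : (g : M4) = phiMat a b c d) : g ∈ stabE3Subgroup k := by
  refine ⟨hg ▸ isSymp_phiMat h, ?_, ?_, ?_, Or.inl ?_⟩ <;> rw [hg]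
  · simpa [phiMat] using hc
  · simp [phiMat]
  · simp [phiMat]
  · ext i
    fin_cases i <;> simp [phiMat, mulVec, dotProduct, Fin.sum_univ_four]

theorem heis_mem_stabE3 {k : ℕ} {g : GL (Fin 4) ℤ} {p q t : ℤ}
    (hq : (k : ℤ) ∣ q) (hg : (g : M4) = heisMat p q t) : g ∈ stabE3Subgroup k := by
  refine ⟨hg ▸ isSymp_heisMat p q t, ?_, ?_, ?_, Or.inl ?_⟩ <;> rw [hg]
  · simp [heisMat]
  · simp [heisMat]
  · simpa [heisMat] using hq
  · ext i
    fin_cases i <;> simp [heisMat, mulVec, dotProduct, Fin.sum_univ_four]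

theorem neg_one_mem_stabE3 (k : ℕ) : (-1 : GL (Fin 4) ℤ) ∈ stabE3Subgroup k := by
  refine ⟨isSymp_neg isSymp_one, ?_, ?_, ?_, Or.inr ?_⟩ <;>
    simp [Units.val_neg, neg_mulVec]

theorem tau_e1 : tau ![1, 0, 0, 0] = phiMat 1 1 0 1 := by decide

theorem tau_e3 : tau ![0, 0, 1, 0] = heisMat 0 0 1 := by decide

theorem tau_e1_sub_e3 : tau ![1, 0, -1, 0] = phiMat 1 1 0 1 * heisMat (-1) 0 1 := by decide

theorem closure_le_stabE3 (k : ℕ) : Subgroup.closure (gensE3 k) ≤ stabE3Subgroup k := by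
  rw [Subgroup.closure_le]
  rintro g (((((⟨a, b, c, d, h, hc, hg⟩ | hg) | hg) | hg) | hg) | hg)
  · exact phi_mem_stabE3 h hc hg
  · exact phi_mem_stabE3 (by norm_num) (dvd_zero _) (hg.trans tau_e1)
  · have : g = phi 1 1 0 1 (by norm_num) * heis (-1) 0 1 := Units.ext (hg.trans tau_e1_sub_e3)
    rw [this]
    exact mul_mem (phi_mem_stabE3 (by norm_num) (dvd_zero _) rfl) (heis_mem_stabE3 (dvd_zero _) rfl)
  · exact heis_mem_stabE3 (dvd_zero _) (hg.trans tau_e3)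
  · exact heis_mem_stabE3 (dvd_refl _) (hg.trans (Mmat_pow k))
  · rw [show g = -1 from Units.ext hg]
    exact neg_one_mem_stabE3 k

theorem Subgroup.mem_of_map_add {G : Type*} [Group G] (S : Subgroup G) (f : ℤ → G)
    (hf : ∀ m n, f (m + n) = f m * f n) (h1 : f 1 ∈ S) (n : ℤ) : f n ∈ S := by
  have h0 : f 0 = 1 := by simpa using hf 0 0
  induction n using Int.induction_on with
  | zero => rw [h0]; exact S.one_mem
  | succ n ih => rw [hf]; exact S.mul_mem ih h1
  | pred n ih =>
    rw [← S.mul_mem_cancel_right h1, ← hf, sub_add_cancel]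
    exact ih

theorem phi_mem_closure {k : ℕ} {a b c d : ℤ} (h : a * d - b * c = 1) (hc : (k : ℤ) ∣ c) :
    phi a b c d h ∈ Subgroup.closure (gensE3 k) := by
  refine Subgroup.subset_closure ?_
  iterate 5 left
  exact ⟨a, b, c, d, h, hc, rfl⟩

theorem neg_one_mem_closure (k : ℕ) : (-1 : GL (Fin 4) ℤ) ∈ Subgroup.closure (gensE3 k) :=
  Subgroup.subset_closure (Or.inr rfl)

theorem heis_mem_closure {k : ℕ} (p : ℤ) {q : ℤ} (t : ℤ) (hq : (k : ℤ) ∣ q) :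
    heis p q t ∈ Subgroup.closure (gensE3 k) := by
  set S := Subgroup.closure (gensE3 k) with hS
  have hT (t : ℤ) : heis 0 0 t ∈ S := by
    refine S.mem_of_map_add (fun t => heis 0 0 t) (fun m n => by simp [heis_mul]) ?_ t
    refine Subgroup.subset_closure (Or.inl (Or.inl (Or.inr ?_)))
    exact tau_e3.symm
  have hQ (n : ℤ) : heis 0 (k * n) 0 ∈ S := by
    refine S.mem_of_map_add (fun n => heis 0 (k * n) 0) (fun m n => by simp [heis_mul, mul_add])
      ?_ n
    refine Subgroup.subset_closure (Or.inl (Or.inr ?_))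
    change heisMat 0 (k * 1) 0 = Mmat ^ k
    rw [Mmat_pow, mul_one]
  have hneg : heis (-1) 0 1 ∈ S := by
    have hphi : phi 1 1 0 1 (by norm_num) ∈ S := phi_mem_closure (by norm_num) (dvd_zero _)
    rw [← S.mul_mem_cancel_left hphi]
    refine Subgroup.subset_closure (Or.inl (Or.inl (Or.inl (Or.inr ?_))))
    exact tau_e1_sub_e3.symm
  have hP (p : ℤ) : heis p 0 0 ∈ S := by
    have := S.mem_of_map_add (fun p => heis (-p) 0 0)
      (fun m n => by simp [heis_mul, add_comm]) ?_ (-p)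
    · simpa using this
    · have := S.mul_mem hneg (hT (-1))
      simpa [heis_mul] using this
  obtain ⟨n, rfl⟩ := hq
  have := S.mul_mem (S.mul_mem (hP p) (hQ n)) (hT (t - p * (k * n)))
  simpa [heis_mul] using this

/-- A symplectic matrix fixing `e₃` is the product of a block `φ` and a Heisenberg matrix. -/
theorem mem_closure_of_fix_e3 {k : ℕ} {A : GL (Fin 4) ℤ} (hA : IsSymp (A : M4))
    (h0 : (k : ℤ) ∣ (A : M4) 1 0) (h3 : (k : ℤ) ∣ (A : M4) 1 3)
    (he : (A : M4) *ᵥ ![0, 0, 1, 0] = ![0, 0, 1, 0]) : A ∈ Subgroup.closure (gensE3 k) := by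
  have col (i : Fin 4) := congrFun he i
  have c0 := col 0
  have c1 := col 1
  have c2 := col 2
  have c3 := col 3
  have w02 := hA ![1, 0, 0, 0] ![0, 0, 1, 0]
  have w12 := hA ![0, 1, 0, 0] ![0, 0, 1, 0]
  have w32 := hA ![0, 0, 0, 1] ![0, 0, 1, 0]
  have w01 := hA ![1, 0, 0, 0] ![0, 1, 0, 0]
  have w03 := hA ![1, 0, 0, 0] ![0, 0, 0, 1]
  have w13 := hA ![0, 1, 0, 0] ![0, 0, 0, 1]
  simp [mulVec, dotProduct, Fin.sum_univ_four] at c0 c1 c2 c3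
  simp [omegaZ, mulVec, dotProduct, Fin.sum_univ_four, c0, c1, c2, c3] at w02 w12 w32
  simp [omegaZ, mulVec, dotProduct, Fin.sum_univ_four, w02, w12, w32] at w01 w03 w13
  have hdet : (A : M4) 0 0 * (A : M4) 1 1 - (A : M4) 0 1 * (A : M4) 1 0 = 1 := by
    linear_combination w01
  have hA' : A = phi _ _ _ _ hdet *
      heis ((A : M4) 2 1) (-(A : M4) 2 0) ((A : M4) 2 3) := by
    refine Units.ext ?_
    change (A : M4) = phiMat _ _ _ _ * heisMat _ _ _
    ext i j
    fin_cases i <;> fin_cases j <;>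
      simp [phiMat, heisMat, mul_apply, Fin.sum_univ_four, c0, c1, c2, c3, w02, w12, w32]
    · linear_combination (A : M4) 0 1 * w03 - (A : M4) 0 0 * w13 - (A : M4) 0 3 * hdet
    · linear_combination (A : M4) 1 1 * w03 - (A : M4) 1 0 * w13 - (A : M4) 1 3 * hdet
  rw [hA']
  refine mul_mem (phi_mem_closure hdet h0) (heis_mem_closure _ _ ?_)
  have : -(A : M4) 2 0 = (A : M4) 0 0 * (A : M4) 1 3 - (A : M4) 1 0 * (A : M4) 0 3 := by
    linear_combination -w03
  rw [this]
  exact dvd_sub (h3.mul_left _) (h0.mul_right _)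

/-- For `k` prime, the stabilizer of `±e₃` in `G_k` is generated by `φ(Γ₀(k))`, the
transvections `τ_{e₁}`, `τ_{e₁−e₃}`, `τ_{e₃}`, the matrix `M^k` and `−I`. -/
theorem stabilizer_e3_eq_closure (k : ℕ) (hk : Nat.Prime k) :
    stabE3 k = (Subgroup.closure (gensE3 k) : Set (GL (Fin 4) ℤ)) := by
  refine Set.Subset.antisymm ?_ (closure_le_stabE3 k)
  rintro A ⟨hA, h0, -, h3, he | he⟩
  · exact mem_closure_of_fix_e3 hA h0 h3 he
  · have h : -A ∈ Subgroup.closure (gensE3 k) := by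
      refine mem_closure_of_fix_e3 (isSymp_neg hA) ?_ ?_ ?_
      · simpa using h0
      · simpa using h3
      · rw [Units.val_neg, neg_mulVec, he, neg_neg]
    have h' := mul_mem (neg_one_mem_closure k) h
    rwa [neg_mul_neg, one_mul] at h'
end

section
/- Let H̄ = {B ∈ Sp(4,ℤ/2ℤ) : B₁₃ = B₁₄ = B₂₃ = B₂₄ = B₃₁ = B₃₂ = B₄₁ = B₄₂ = 0}. Then the natural action of H̄ on the 15 nonzero vectors of (ℤ/2ℤ)⁴ has exactly three orbits: the orbit of e₁, which equals {e₁, e₂, e₁+e₂}; the orbit of e₃, which equals {e₃, e₄, e₃+e₄}; and the orbit of e₁+e₃, which equals the nine remaining nonzero vectors {e₁+e₃, e₁+e₂+e₃, e₁+e₂+e₄, e₁+e₂+e₃+e₄, e₂+e₃+e₄, e₂+e₃, e₂+e₄, e₁+e₄, e₁+e₃+e₄}. -/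
/-- The standard symplectic form on `(ℤ/2ℤ)⁴`: `ω₂(x,y) = x₁y₂ − x₂y₁ + x₃y₄ − x₄y₃`
(written with 0-based indices). -/
def omega2 (x y : Fin 4 → ZMod 2) : ZMod 2 :=
  x 0 * y 1 - x 1 * y 0 + x 2 * y 3 - x 3 * y 2

/-- `B ∈ Sp(4, ℤ/2ℤ)`: `B` preserves the symplectic form `ω₂`. -/
def IsSympMod2 (B : Matrix (Fin 4) (Fin 4) (ZMod 2)) : Prop :=
  ∀ x y : Fin 4 → ZMod 2, omega2 (B.mulVec x) (B.mulVec y) = omega2 x y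

/-- `H̄ = {B ∈ Sp(4,ℤ/2ℤ) : B₁₃ = B₁₄ = B₂₃ = B₂₄ = B₃₁ = B₃₂ = B₄₁ = B₄₂ = 0}`
(1-based entries). -/
def Hbar : Set (Matrix (Fin 4) (Fin 4) (ZMod 2)) :=
  {B | IsSympMod2 B ∧ B 0 2 = 0 ∧ B 0 3 = 0 ∧ B 1 2 = 0 ∧ B 1 3 = 0 ∧
       B 2 0 = 0 ∧ B 2 1 = 0 ∧ B 3 0 = 0 ∧ B 3 1 = 0}

theorem block_det_eq_one_of_mem_Hbar {B : Matrix (Fin 4) (Fin 4) (ZMod 2)} (hB : B ∈ Hbar) :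
    B 0 0 * B 1 1 - B 1 0 * B 0 1 = 1 ∧ B 2 2 * B 3 3 - B 3 2 * B 2 3 = 1 := by
  obtain ⟨hs, h02, h03, h12, h13, h20, h21, h30, h31⟩ := hB
  have h₁ := hs ![1, 0, 0, 0] ![0, 1, 0, 0]
  have h₂ := hs ![0, 0, 1, 0] ![0, 0, 0, 1]
  simp [omega2, Matrix.mulVec, dotProduct, Fin.sum_univ_four, *] at h₁ h₂
  exact ⟨h₁, h₂⟩

/-- A block diagonal matrix with `(p, q)` and `(r, s)` as first columns of its blocks. -/
def blockWithColumns (p q r s : ZMod 2) : Matrix (Fin 4) (Fin 4) (ZMod 2) :=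
  !![p, q * (1 - p), 0, 0; q, p, 0, 0; 0, 0, r, s * (1 - r); 0, 0, s, r]

theorem det_completion {p q : ZMod 2} (h : ¬(p = 0 ∧ q = 0)) :
    p * p - q * (q * (1 - p)) = 1 := by
  revert p q
  decide

theorem blockWithColumns_mem_Hbar {p q r s : ZMod 2} (hpq : ¬(p = 0 ∧ q = 0))
    (hrs : ¬(r = 0 ∧ s = 0)) : blockWithColumns p q r s ∈ Hbar := by
  refine ⟨fun x y => ?_, by simp [blockWithColumns]⟩
  have h₁ := det_completion hpq
  have h₂ := det_completion hrs
  simp only [blockWithColumns, omega2, Matrix.mulVec, dotProduct, Fin.sum_univ_four,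
    Matrix.of_apply, Matrix.cons_val]
  linear_combination (x 0 * y 1 - x 1 * y 0) * h₁ + (x 2 * y 3 - x 3 * y 2) * h₂

/-- The orbit of `a e₁ + b e₃` under `H̄`, described by its two planar components. -/
theorem exists_mem_Hbar_mulVec_eq_iff (a b : ZMod 2) (v : Fin 4 → ZMod 2) :
    (∃ B ∈ Hbar, B.mulVec ![a, 0, b, 0] = v) ↔
      (a = 0 ↔ v 0 = 0 ∧ v 1 = 0) ∧ (b = 0 ↔ v 2 = 0 ∧ v 3 = 0) := by
  constructor
  · rintro ⟨B, hB, rfl⟩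
    obtain ⟨h₁, h₂⟩ := block_det_eq_one_of_mem_Hbar hB
    obtain ⟨-, h02, h03, h12, h13, h20, h21, h30, h31⟩ := hB
    have key : ∀ p q t u c : ZMod 2, p * t - q * u = 1 → (c = 0 ↔ p * c = 0 ∧ q * c = 0) := by
      decide
    simpa [Matrix.mulVec, dotProduct, Fin.sum_univ_four, *] using
      And.intro (key _ _ _ _ a h₁) (key _ _ _ _ b h₂)
  · rintro ⟨ha, hb⟩
    have key : ∀ c p q : ZMod 2, (c = 0 ↔ p = 0 ∧ q = 0) →
        ∃ p' q', ¬(p' = 0 ∧ q' = 0) ∧ p' * c = p ∧ q' * c = q := by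
      decide
    obtain ⟨p, q, hpq, hp, hq⟩ := key _ _ _ ha
    obtain ⟨r, s, hrs, hr, hs⟩ := key _ _ _ hb
    refine ⟨blockWithColumns p q r s, blockWithColumns_mem_Hbar hpq hrs, ?_⟩
    ext i
    fin_cases i <;>
      simpa [blockWithColumns, Matrix.mulVec, dotProduct, Fin.sum_univ_four]

/-- The action of `H̄` on the 15 nonzero vectors of `(ℤ/2ℤ)⁴` has exactly three orbits:
the orbit of `e₁` is `{e₁, e₂, e₁+e₂}`, the orbit of `e₃` is `{e₃, e₄, e₃+e₄}`, and the
orbit of `e₁+e₃` consists of the nine remaining nonzero vectors. -/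
theorem Hbar_orbits_on_nonzero_vectors (v : Fin 4 → ZMod 2) (hv : v ≠ 0) :
    ((∃ B ∈ Hbar, B.mulVec ![1, 0, 0, 0] = v) ↔
      v ∈ ({![1, 0, 0, 0], ![0, 1, 0, 0], ![1, 1, 0, 0]} : Set (Fin 4 → ZMod 2))) ∧
    ((∃ B ∈ Hbar, B.mulVec ![0, 0, 1, 0] = v) ↔
      v ∈ ({![0, 0, 1, 0], ![0, 0, 0, 1], ![0, 0, 1, 1]} : Set (Fin 4 → ZMod 2))) ∧
    ((∃ B ∈ Hbar, B.mulVec ![1, 0, 1, 0] = v) ↔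
      v ∈ ({![1, 0, 1, 0], ![1, 1, 1, 0], ![1, 1, 0, 1], ![1, 1, 1, 1], ![0, 1, 1, 1],
            ![0, 1, 1, 0], ![0, 1, 0, 1], ![1, 0, 0, 1], ![1, 0, 1, 1]} :
        Set (Fin 4 → ZMod 2))) := by
  rw [exists_mem_Hbar_mulVec_eq_iff, exists_mem_Hbar_mulVec_eq_iff,
    exists_mem_Hbar_mulVec_eq_iff]
  simp only [Set.mem_insert_iff, Set.mem_singleton_iff]
  clear hv
  revert v
  decide
end

section
/- Let H̄ = {B ∈ Sp(4,ℤ/2ℤ) : B₁₃ = B₁₄ = B₂₃ = B₂₄ = B₃₁ = B₃₂ = B₄₁ = B₄₂ = 0}, acting diagonally on unordered pairs of vectors. Then the set of unordered pairs {x,y} of nonzero vectors of (ℤ/2ℤ)⁴ with ω₂(x,y) = 1 decomposes into exactly six H̄-orbits, represented by the pairwise inequivalent pairs {e₁, e₂}, {e₃, e₄}, {e₁+e₃, e₁+e₂+e₃}, {e₁+e₃, e₁+e₃+e₄}, {e₂, e₁+e₃} and {e₄, e₁+e₃}. Moreover, ω₂(x,y) = 0 whenever x ∈ {e₁, e₂,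 e₁+e₂} and y ∈ {e₃, e₄, e₃+e₄}. -/
/-- Two (ordered) pairs of vectors represent the same `H̄`-orbit of unordered pairs. -/
def PairEquiv2 (p q : (Fin 4 → ZMod 2) × (Fin 4 → ZMod 2)) : Prop :=
  ∃ B ∈ Hbar,
    (B.mulVec p.1 = q.1 ∧ B.mulVec p.2 = q.2) ∨ (B.mulVec p.1 = q.2 ∧ B.mulVec p.2 = q.1)

/-- The six orbit representatives `{e₁,e₂}`, `{e₃,e₄}`, `{e₁+e₃, e₁+e₂+e₃}`,
`{e₁+e₃, e₁+e₃+e₄}`, `{e₂, e₁+e₃}`, `{e₄, e₁+e₃}`. -/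
def pairRep2 : Fin 6 → (Fin 4 → ZMod 2) × (Fin 4 → ZMod 2) :=
  ![(![1, 0, 0, 0], ![0, 1, 0, 0]),
    (![0, 0, 1, 0], ![0, 0, 0, 1]),
    (![1, 0, 1, 0], ![1, 1, 1, 0]),
    (![1, 0, 1, 0], ![1, 0, 1, 1]),
    (![0, 1, 0, 0], ![1, 0, 1, 0]),
    (![0, 0, 0, 1], ![1, 0, 1, 0])]

/-- The block-diagonal matrix with `2 × 2` blocks `(a b; c d)` and `(e f; g h)`. -/
def blockMatrix (a b c d e f g h : ZMod 2) : Matrix (Fin 4) (Fin 4) (ZMod 2) :=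
  !![a, b, 0, 0; c, d, 0, 0; 0, 0, e, f; 0, 0, g, h]

theorem blockMatrix_mulVec (a b c d e f g h : ZMod 2) (x : Fin 4 → ZMod 2) :
    (blockMatrix a b c d e f g h).mulVec x =
      ![a * x 0 + b * x 1, c * x 0 + d * x 1, e * x 2 + f * x 3, g * x 2 + h * x 3] := by
  ext i
  fin_cases i <;> simp [blockMatrix, Matrix.mulVec, dotProduct, Fin.sum_univ_four]

/-- `H̄` consists of the block-diagonal matrices whose blocks have determinant one. -/
theorem mem_Hbar_iff (B : Matrix (Fin 4) (Fin 4) (ZMod 2)) :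
    B ∈ Hbar ↔ ∃ a b c d e f g h : ZMod 2, a * d - b * c = 1 ∧ e * h - f * g = 1 ∧
      B = blockMatrix a b c d e f g h := by
  constructor
  · rintro ⟨hB, h₀₂, h₀₃, h₁₂, h₁₃, h₂₀, h₂₁, h₃₀, h₃₁⟩
    have hblock : B = blockMatrix (B 0 0) (B 0 1) (B 1 0) (B 1 1)
        (B 2 2) (B 2 3) (B 3 2) (B 3 3) := by
      ext i j
      fin_cases i <;> fin_cases j <;> simp [blockMatrix, *]
    refine ⟨_, _, _, _, _, _, _, _, ?_, ?_, hblock⟩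
    · have h := hB ![1, 0, 0, 0] ![0, 1, 0, 0]
      rw [hblock, blockMatrix_mulVec, blockMatrix_mulVec] at h
      simp [omega2] at h
      linear_combination h
    · have h := hB ![0, 0, 1, 0] ![0, 0, 0, 1]
      rw [hblock, blockMatrix_mulVec, blockMatrix_mulVec] at h
      simp [omega2] at h
      linear_combination h
  · rintro ⟨a, b, c, d, e, f, g, h, h₁, h₂, rfl⟩
    refine ⟨fun x y => ?_, by simp [blockMatrix]⟩
    simp only [blockMatrix_mulVec, omega2, Matrix.cons_val]
    linear_combination (x 0 * y 1 - x 1 * y 0) * h₁ + (x 2 * y 3 - x 3 * y 2) * h₂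

/-- `SL(2, ℤ/2ℤ)` acts transitively on the ordered pairs of determinant one. -/
theorem exists_map_of_det_eq_one : ∀ x₀ x₁ y₀ y₁ p₀ p₁ q₀ q₁ : ZMod 2,
    x₀ * y₁ - x₁ * y₀ = 1 → p₀ * q₁ - p₁ * q₀ = 1 →
    ∃ a b c d : ZMod 2, a * d - b * c = 1 ∧ a * x₀ + b * x₁ = p₀ ∧ c * x₀ + d * x₁ = p₁ ∧
      a * y₀ + b * y₁ = q₀ ∧ c * y₀ + d * y₁ = q₁ := by
  decide

/-- A pair of determinant zero over `ℤ/2ℤ` can be moved into the line spanned by `(1, 0)`. -/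
theorem exists_map_of_det_eq_zero : ∀ x₀ x₁ y₀ y₁ : ZMod 2, x₀ * y₁ - x₁ * y₀ = 0 →
    ∃ s t a b c d : ZMod 2, a * d - b * c = 1 ∧ a * x₀ + b * x₁ = s ∧ c * x₀ + d * x₁ = 0 ∧
      a * y₀ + b * y₁ = t ∧ c * y₀ + d * y₁ = 0 := by
  decide

/-- Two pairs are equivalent when their blocks are related by matrices of determinant one. -/
theorem pairEquiv2_of_blocks {x y p q : Fin 4 → ZMod 2}
    (h₁ : ∃ a b c d : ZMod 2, a * d - b * c = 1 ∧ a * x 0 + b * x 1 = p 0 ∧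
      c * x 0 + d * x 1 = p 1 ∧ a * y 0 + b * y 1 = q 0 ∧ c * y 0 + d * y 1 = q 1)
    (h₂ : ∃ a b c d : ZMod 2, a * d - b * c = 1 ∧ a * x 2 + b * x 3 = p 2 ∧
      c * x 2 + d * x 3 = p 3 ∧ a * y 2 + b * y 3 = q 2 ∧ c * y 2 + d * y 3 = q 3) :
    PairEquiv2 (x, y) (p, q) := by
  obtain ⟨a, b, c, d, h, h₁₁, h₁₂, h₁₃, h₁₄⟩ := h₁
  obtain ⟨e, f, g, k, h', h₂₁, h₂₂, h₂₃, h₂₄⟩ := h₂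
  refine ⟨_, (mem_Hbar_iff _).2 ⟨a, b, c, d, e, f, g, k, h, h', rfl⟩, Or.inl ⟨?_, ?_⟩⟩ <;>
    rw [blockMatrix_mulVec] <;> ext i <;> fin_cases i <;> simpa

theorem PairEquiv2.swap_right {x y p q : Fin 4 → ZMod 2} (h : PairEquiv2 (x, y) (p, q)) :
    PairEquiv2 (x, y) (q, p) := by
  obtain ⟨B, hB, h⟩ := h
  exact ⟨B, hB, h.symm⟩

theorem exists_pairEquiv2_pairRep2 (x y : Fin 4 → ZMod 2) (h : omega2 x y = 1) :
    ∃ a : Fin 6, PairEquiv2 (x, y) (pairRep2 a) := by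
  have key : ∀ u v : ZMod 2, u + v = 1 → u = 1 ∧ v = 0 ∨ u = 0 ∧ v = 1 := by decide
  have zero_or_one : ∀ s : ZMod 2, s = 0 ∨ s = 1 := by decide
  rcases key (x 0 * y 1 - x 1 * y 0) (x 2 * y 3 - x 3 * y 2)
    (by rw [← h, omega2]; ring) with ⟨h₁, h₂⟩ | ⟨h₁, h₂⟩
  · obtain ⟨s, t, h₂⟩ := exists_map_of_det_eq_zero _ _ _ _ h₂
    rcases zero_or_one s with rfl | rfl <;> rcases zero_or_one t with rfl | rfl
    · exact ⟨0, pairEquiv2_of_blocks (exists_map_of_det_eq_one _ _ _ _ _ _ _ _ h₁ (by decide)) h₂⟩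
    · exact ⟨4, pairEquiv2_of_blocks (exists_map_of_det_eq_one _ _ _ _ _ _ _ _ h₁ (by decide)) h₂⟩
    · exact ⟨4, (pairEquiv2_of_blocks
        (exists_map_of_det_eq_one _ _ _ _ _ _ _ _ h₁ (by decide)) h₂).swap_right⟩
    · exact ⟨2, pairEquiv2_of_blocks (exists_map_of_det_eq_one _ _ _ _ _ _ _ _ h₁ (by decide)) h₂⟩
  · obtain ⟨s, t, h₁⟩ := exists_map_of_det_eq_zero _ _ _ _ h₁
    rcases zero_or_one s with rfl | rfl <;> rcases zero_or_one t with rfl | rfl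
    · exact ⟨1, pairEquiv2_of_blocks h₁ (exists_map_of_det_eq_one _ _ _ _ _ _ _ _ h₂ (by decide))⟩
    · exact ⟨5, pairEquiv2_of_blocks h₁ (exists_map_of_det_eq_one _ _ _ _ _ _ _ _ h₂ (by decide))⟩
    · exact ⟨5, (pairEquiv2_of_blocks h₁
        (exists_map_of_det_eq_one _ _ _ _ _ _ _ _ h₂ (by decide))).swap_right⟩
    · exact ⟨3, pairEquiv2_of_blocks h₁ (exists_map_of_det_eq_one _ _ _ _ _ _ _ _ h₂ (by decide))⟩

theorem pairRep2_inequivalent (i j : Fin 6) (h : PairEquiv2 (pairRep2 i) (pairRep2 j)) :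
    i = j := by
  obtain ⟨B, hB, h⟩ := h
  obtain ⟨a, b, c, d, e, f, g, k, h₁, h₂, rfl⟩ := (mem_Hbar_iff B).1 hB
  simp only [blockMatrix_mulVec] at h
  fin_cases i <;> fin_cases j <;> first
    | rfl
    | simp [pairRep2, Fin.forall_fin_succ, funext_iff] at h
      try grind

/-- The unordered pairs `{x,y}` of nonzero vectors of `(ℤ/2ℤ)⁴` with `ω₂(x,y) = 1`
decompose into exactly six `H̄`-orbits, represented by the pairwise inequivalent pairs
listed in `pairRep2`; moreover `ω₂(x,y) = 0` whenever `x ∈ {e₁,e₂,e₁+e₂}` and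
`y ∈ {e₃,e₄,e₃+e₄}`. -/
theorem Hbar_orbits_on_pairs :
    (∀ x y : Fin 4 → ZMod 2, x ≠ 0 → y ≠ 0 → omega2 x y = 1 →
      ∃ a : Fin 6, PairEquiv2 (x, y) (pairRep2 a)) ∧
    (∀ a b : Fin 6, PairEquiv2 (pairRep2 a) (pairRep2 b) → a = b) ∧
    (∀ x ∈ ({![1, 0, 0, 0], ![0, 1, 0, 0], ![1, 1, 0, 0]} : Set (Fin 4 → ZMod 2)),
     ∀ y ∈ ({![0, 0, 1, 0], ![0, 0, 0, 1], ![0, 0, 1, 1]} : Set (Fin 4 → ZMod 2)),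
      omega2 x y = 0) := by
  refine ⟨fun x y _ _ h => exists_pairEquiv2_pairRep2 x y h, pairRep2_inequivalent, ?_⟩
  rintro x (rfl | rfl | rfl) y (rfl | rfl | rfl) <;> decide
end

section
/- Let G be a group and let x, y ∈ G satisfy the braid relation x·y·x = y·x·y. Then (xy)⁶ = (x²y)⁴, (xy)⁶ = (x³y)³, and (xy)³ = (y⁻¹xy⁻¹)·y³·x·y³. -/
section Braid

variable {M : Type*} [Monoid M] {x y : M}

theorem semiconjBy_of_braid (h : x * y * x = y * x * y) : SemiconjBy (x * y * x) x y := by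
  calc x * y * x * x = y * x * y * x := by rw [h]
    _ = y * (x * y * x) := by simp only [mul_assoc]

theorem mul_pow_three_of_braid (h : x * y * x = y * x * y) :
    (x * y) ^ 3 = x * y * x * (x * y * x) := by
  calc (x * y) ^ 3 = x * y * x * (y * x * y) := by
        simp only [pow_succ, pow_zero, one_mul, mul_assoc]
    _ = x * y * x * (x * y * x) := by rw [h]

theorem commute_mul_pow_three_left_of_braid (h : x * y * x = y * x * y) :
    Commute ((x * y) ^ 3) x := by
  have hyx : SemiconjBy (x * y * x) y x := by
    rw [h]
    exact semiconjBy_of_braid h.symm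
  rw [mul_pow_three_of_braid h]
  exact hyx.mul_left (semiconjBy_of_braid h)

theorem commute_mul_pow_three_right_of_braid (h : x * y * x = y * x * y) :
    Commute ((x * y) ^ 3) y := by
  have hyx : SemiconjBy (x * y * x) y x := by
    rw [h]
    exact semiconjBy_of_braid h.symm
  rw [mul_pow_three_of_braid h]
  exact (semiconjBy_of_braid h).mul_left hyx

theorem sq_mul_sq_of_braid (h : x * y * x = y * x * y) : (x ^ 2 * y) ^ 2 = (x * y) ^ 3 := by
  calc (x ^ 2 * y) ^ 2 = x * (x * y * x) * x * y := by
        simp only [pow_succ, pow_zero, one_mul, mul_assoc]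
    _ = x * (y * x * y) * x * y := by rw [h]
    _ = (x * y) ^ 3 := by simp only [pow_succ, pow_zero, one_mul, mul_assoc]

theorem cube_mul_cube_of_braid (h : x * y * x = y * x * y) : (x ^ 3 * y) ^ 3 = (x * y) ^ 6 := by
  calc (x ^ 3 * y) ^ 3 = x ^ 2 * (x * y * x * x) * (x * y * x) * (x ^ 2 * y) := by
        simp only [pow_succ, pow_zero, one_mul, mul_assoc]
    _ = x ^ 2 * (y * (x * y * x)) * (x * y * x) * (x ^ 2 * y) := by
        rw [(semiconjBy_of_braid h).eq]
    _ = x ^ 2 * y * ((x * y * x * (x * y * x)) * (x ^ 2 * y)) := by simp only [mul_assoc]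
    _ = x ^ 2 * y * ((x ^ 2 * y) * (x * y) ^ 3) := by
        rw [← mul_pow_three_of_braid h, (((commute_mul_pow_three_left_of_braid h).pow_right
          2).mul_right (commute_mul_pow_three_right_of_braid h)).eq]
    _ = (x * y) ^ 6 := by rw [← mul_assoc, ← sq, sq_mul_sq_of_braid h, ← pow_add]

end Braid

/-- If `x` and `y` satisfy the braid relation `x·y·x = y·x·y` in a group `G`, then
`(xy)⁶ = (x²y)⁴`, `(xy)⁶ = (x³y)³`, and `(xy)³ = (y⁻¹xy⁻¹)·y³·x·y³`. -/
theorem braid_relation_twist_identities {G : Type*} [Group G] (x y : G)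
    (h : x * y * x = y * x * y) :
    (x * y) ^ 6 = (x ^ 2 * y) ^ 4 ∧
    (x * y) ^ 6 = (x ^ 3 * y) ^ 3 ∧
    (x * y) ^ 3 = (y⁻¹ * x * y⁻¹) * y ^ 3 * x * y ^ 3 := by
  refine ⟨?_, (cube_mul_cube_of_braid h).symm, ?_⟩
  · rw [show 4 = 2 * 2 from rfl, pow_mul (x ^ 2 * y), sq_mul_sq_of_braid h, ← pow_mul]
  · symm
    calc y⁻¹ * x * y⁻¹ * y ^ 3 * x * y ^ 3 = y⁻¹ * (x * y * (y * x * y) * y * y) := by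
          simp only [pow_succ, pow_zero, one_mul, mul_assoc, inv_mul_cancel_left]
      _ = y⁻¹ * (x * y * (x * y * x) * y * y) := by rw [h]
      _ = y⁻¹ * ((x * y) ^ 3 * y) := by simp only [pow_succ, pow_zero, one_mul, mul_assoc]
      _ = (x * y) ^ 3 := by
          rw [(commute_mul_pow_three_right_of_braid h).eq, inv_mul_cancel_left]
end
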